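/- Let (n, p, θ, φ) be a smooth solution of the PNPF system with c^p = c^n = c > 1 and D^p = D^n = k = 1, with n > 0, p > 0. Then the functions ũ = n + p − 2, v = n − p, θ̃ = θ − 1 satisfy: (i) ∂_t ũ = Δũ + 2Δθ̃ + θ̃Δũ + ũΔθ̃ + 2∇θ̃·∇ũ − ∇v·∇φ − v²; (ii) ∂_t v = Δv − 2v + θ̃Δv + vΔθ̃ + 2∇θ̃·∇v − ∇ũ·∇φ − ũv; (iii) c ∂_t θ̃ = (3/2)Δθ̃ + (1/2)Δũ + θ̃Δθ̃ − (ũ/(2(2+ũ)))Δθ̃ + ((2θ̃² + 4θ̃ − ũ)/(2(2+ũ)))Δũ + (c+1)|∇θ̃|² + (c+3)((1+θ̃)/(2+ũ))∇ũ·∇θ̃ − 2((1+θ̃)/(2+ũ))∇v·∇φ − (c+2)(v/(2+ũ))∇θ̃·∇φ − ((1+θ̃)/(2+ũ))v² + |∇φ|². -/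

import Mathlib

open MeasureTheory Filter Topology Real

noncomputable section

/-- Euclidean space ℝ³. -/
abbrev E3 : Type := EuclideanSpace ℝ (Fin 3)

/-- The `i`-th partial derivative `∂ᵢ f`. -/
def pd (i : Fin 3) (f : E3 → ℝ) (x : E3) : ℝ :=
  fderiv ℝ f x (EuclideanSpace.single i 1)

/-- The Laplacian `Δf`. -/
def lap (f : E3 → ℝ) (x : E3) : ℝ := ∑ i : Fin 3, pd i (pd i f) x

/-- The dot product of gradients `∇f · ∇g`. -/
def gdot (f g : E3 → ℝ) (x : E3) : ℝ := ∑ i : Fin 3, pd i f x * pd i g x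

theorem pd_add (i : Fin 3) {f g : E3 → ℝ} {x : E3} (hf : DifferentiableAt ℝ f x)
    (hg : DifferentiableAt ℝ g x) :
    pd i (fun y => f y + g y) x = pd i f x + pd i g x := by
  simp [pd, fderiv_fun_add hf hg]

theorem pd_sub (i : Fin 3) {f g : E3 → ℝ} {x : E3} (hf : DifferentiableAt ℝ f x)
    (hg : DifferentiableAt ℝ g x) :
    pd i (fun y => f y - g y) x = pd i f x - pd i g x := by
  simp [pd, fderiv_fun_sub hf hg]

theorem pd_sub_const (i : Fin 3) (f : E3 → ℝ) (a : ℝ) (x : E3) :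
    pd i (fun y => f y - a) x = pd i f x := by
  simp [pd, fderiv_sub_const]

theorem pd_mul (i : Fin 3) {f g : E3 → ℝ} {x : E3} (hf : DifferentiableAt ℝ f x)
    (hg : DifferentiableAt ℝ g x) :
    pd i (fun y => f y * g y) x = f x * pd i g x + g x * pd i f x := by
  simp [pd, fderiv_fun_mul hf hg]

theorem pd_inv (i : Fin 3) {f : E3 → ℝ} {x : E3} (hf : DifferentiableAt ℝ f x)
    (hx : f x ≠ 0) : pd i (fun y => (f y)⁻¹) x = -(pd i f x / f x ^ 2) := by
  have h : HasFDerivAt (fun y => (f y)⁻¹) (-(f x ^ 2)⁻¹ • fderiv ℝ f x) x :=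
    (hasDerivAt_inv hx).comp_hasFDerivAt x hf.hasFDerivAt
  simp [pd, h.fderiv, div_eq_inv_mul]

theorem ContDiff.pd {f : E3 → ℝ} (hf : ContDiff ℝ (⊤ : ℕ∞) f) (i : Fin 3) :
    ContDiff ℝ (⊤ : ℕ∞) (pd i f) :=
  (hf.fderiv_right (m := (⊤ : ℕ∞)) (by simp)).clm_apply contDiff_const

theorem ContDiff.differentiableAt_of_smooth {f : E3 → ℝ} (hf : ContDiff ℝ (⊤ : ℕ∞) f) (x : E3) :
    DifferentiableAt ℝ f x :=
  hf.differentiable (by simp) x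

theorem pd_pd_mul (i : Fin 3) {f g : E3 → ℝ} (hf : ContDiff ℝ (⊤ : ℕ∞) f)
    (hg : ContDiff ℝ (⊤ : ℕ∞) g) (x : E3) :
    pd i (pd i (fun y => f y * g y)) x =
      f x * pd i (pd i g) x + 2 * (pd i f x * pd i g x) + g x * pd i (pd i f) x := by
  have h : pd i (fun y => f y * g y) = fun y => f y * pd i g y + g y * pd i f y :=
    funext fun y => pd_mul i (hf.differentiableAt_of_smooth y) (hg.differentiableAt_of_smooth y)
  have f0 := hf.differentiableAt_of_smooth x
  have g0 := hg.differentiableAt_of_smooth x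
  have f1 := (hf.pd i).differentiableAt_of_smooth x
  have g1 := (hg.pd i).differentiableAt_of_smooth x
  rw [h, pd_add i (f0.fun_mul g1) (g0.fun_mul f1), pd_mul i f0 g1, pd_mul i g0 f1]
  ring

theorem lap_add {f g : E3 → ℝ} (hf : ContDiff ℝ (⊤ : ℕ∞) f) (hg : ContDiff ℝ (⊤ : ℕ∞) g)
    (x : E3) : lap (fun y => f y + g y) x = lap f x + lap g x := by
  simp only [lap, ← Finset.sum_add_distrib]
  refine Finset.sum_congr rfl fun i _ => ?_
  rw [← pd_add i ((hf.pd i).differentiableAt_of_smooth x)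
    ((hg.pd i).differentiableAt_of_smooth x)]
  exact congrArg (pd i · x) (funext fun y =>
    pd_add i (hf.differentiableAt_of_smooth y) (hg.differentiableAt_of_smooth y))

theorem lap_sub {f g : E3 → ℝ} (hf : ContDiff ℝ (⊤ : ℕ∞) f) (hg : ContDiff ℝ (⊤ : ℕ∞) g)
    (x : E3) : lap (fun y => f y - g y) x = lap f x - lap g x := by
  simp only [lap, ← Finset.sum_sub_distrib]
  refine Finset.sum_congr rfl fun i _ => ?_
  rw [← pd_sub i ((hf.pd i).differentiableAt_of_smooth x)
    ((hg.pd i).differentiableAt_of_smooth x)]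
  exact congrArg (pd i · x) (funext fun y =>
    pd_sub i (hf.differentiableAt_of_smooth y) (hg.differentiableAt_of_smooth y))

theorem lap_sub_const (f : E3 → ℝ) (a : ℝ) (x : E3) :
    lap (fun y => f y - a) x = lap f x := by
  have h : ∀ i, pd i (fun y => f y - a) = pd i f := fun i => funext (pd_sub_const i f a)
  simp only [lap, h]

theorem lap_mul {f g : E3 → ℝ} (hf : ContDiff ℝ (⊤ : ℕ∞) f) (hg : ContDiff ℝ (⊤ : ℕ∞) g)
    (x : E3) :
    lap (fun y => f y * g y) x = f x * lap g x + 2 * gdot f g x + g x * lap f x := by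
  simp only [lap, gdot, pd_pd_mul _ hf hg, Finset.sum_add_distrib, Finset.mul_sum]

theorem gdot_comm (f g : E3 → ℝ) (x : E3) : gdot f g x = gdot g f x := by
  simp only [gdot, mul_comm]

theorem gdot_add_left {f g : E3 → ℝ} (h : E3 → ℝ) {x : E3} (hf : DifferentiableAt ℝ f x)
    (hg : DifferentiableAt ℝ g x) :
    gdot (fun y => f y + g y) h x = gdot f h x + gdot g h x := by
  simp only [gdot, pd_add _ hf hg, add_mul, Finset.sum_add_distrib]

theorem gdot_sub_left {f g : E3 → ℝ} (h : E3 → ℝ) {x : E3} (hf : DifferentiableAt ℝ f x)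
    (hg : DifferentiableAt ℝ g x) :
    gdot (fun y => f y - g y) h x = gdot f h x - gdot g h x := by
  simp only [gdot, pd_sub _ hf hg, sub_mul, Finset.sum_sub_distrib]

theorem gdot_sub_const_left (f h : E3 → ℝ) (a : ℝ) (x : E3) :
    gdot (fun y => f y - a) h x = gdot f h x := by
  simp only [gdot, pd_sub_const]

theorem gdot_sub_const_right (f h : E3 → ℝ) (a : ℝ) (x : E3) :
    gdot h (fun y => f y - a) x = gdot h f x := by
  simp only [gdot, pd_sub_const]

/-- The derivative of the velocity of a species of density `f`, temperature `g`, charge `σ`. -/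
theorem pd_velocity (i : Fin 3) (σ : ℝ) {f g h : E3 → ℝ} (hf : ContDiff ℝ (⊤ : ℕ∞) f)
    (hg : ContDiff ℝ (⊤ : ℕ∞) g) (hh : ContDiff ℝ (⊤ : ℕ∞) h) (hpos : ∀ y, f y ≠ 0) (x : E3) :
    pd i (fun y => (1 / f y) * (pd i (fun z => f z * g z) y + σ * (f y * pd i h y))) x =
      (g x * pd i (pd i f) x + pd i g x * pd i f x) / f x - g x * pd i f x ^ 2 / f x ^ 2
        + pd i (pd i g) x + σ * pd i (pd i h) x := by
  have f0 := hf.differentiableAt_of_smooth x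
  have g0 := hg.differentiableAt_of_smooth x
  have fi := f0.fun_inv (hpos x)
  have f1 := (hf.pd i).differentiableAt_of_smooth x
  have g1 := (hg.pd i).differentiableAt_of_smooth x
  have h1 := (hh.pd i).differentiableAt_of_smooth x
  have e : (fun y => (1 / f y) * (pd i (fun z => f z * g z) y + σ * (f y * pd i h y))) =
      fun y => ((g y * pd i f y) * (f y)⁻¹ + pd i g y) + σ * pd i h y := by
    funext y
    have := hpos y
    rw [pd_mul i (hf.differentiableAt_of_smooth y) (hg.differentiableAt_of_smooth y)]
    field_simp
    ring
  have hσ : pd i (fun y => σ * pd i h y) x = σ * pd i (pd i h) x := by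
    rw [pd_mul i (differentiableAt_const σ) h1]
    simp [pd]
  have hx := hpos x
  rw [e, pd_add i (((g0.fun_mul f1).fun_mul fi).fun_add g1) (h1.const_mul σ),
    pd_add i ((g0.fun_mul f1).fun_mul fi) g1, pd_mul i (g0.fun_mul f1) fi, pd_mul i g0 f1,
    pd_inv i f0 hx, hσ]
  field_simp
  ring

/-- The pressure work and the Joule heat of one species, with the singular terms cancelled. -/
theorem species_heating (σ : ℝ) (hσ : σ ^ 2 = 1) {f g h : E3 → ℝ} (hf : ContDiff ℝ (⊤ : ℕ∞) f)
    (hg : ContDiff ℝ (⊤ : ℕ∞) g) (hh : ContDiff ℝ (⊤ : ℕ∞) h) (hpos : ∀ y, f y ≠ 0) (x : E3) :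
    f x * g x * (∑ i : Fin 3,
        pd i (fun y => (1 / f y) * (pd i (fun z => f z * g z) y + σ * (f y * pd i h y))) x)
      + (1 / f x) * (∑ i : Fin 3,
        (pd i (fun y => f y * g y) x + σ * (f x * pd i h x)) ^ 2) =
      g x ^ 2 * lap f x + 3 * g x * gdot f g x + f x * g x * (lap g x + σ * lap h x)
        + f x * (gdot g g x + gdot h h x) + 2 * σ * g x * gdot f h x
        + 2 * σ * f x * gdot g h x := by
  have hx := hpos x
  simp only [pd_velocity _ σ hf hg hh hpos, lap, gdot, Finset.mul_sum,
    ← Finset.sum_add_distrib]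
  refine Finset.sum_congr rfl fun i _ => ?_
  rw [pd_mul i (hf.differentiableAt_of_smooth x) (hg.differentiableAt_of_smooth x)]
  field_simp
  linear_combination (f x ^ 2 * pd i h x ^ 2) * hσ

/-- **Reformulation of the PNPF system.** If `(n, p, θ, φ)` is a smooth
solution of the PNPF system with `c^p = c^n = c > 1`, `D^p = D^n = k = 1` and
`n, p > 0`, then `ũ = n + p - 2`, `v = n - p`, `θ̃ = θ - 1` satisfy the
reformulated equations (i), (ii), (iii). -/
theorem pnpf_reformulation (c : ℝ) (hc : 1 < c)
    (n p θ φ : ℝ → E3 → ℝ)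
    (hn : ContDiff ℝ (⊤ : ℕ∞) (fun q : ℝ × E3 => n q.1 q.2))
    (hp : ContDiff ℝ (⊤ : ℕ∞) (fun q : ℝ × E3 => p q.1 q.2))
    (hθ : ContDiff ℝ (⊤ : ℕ∞) (fun q : ℝ × E3 => θ q.1 q.2))
    (hφ : ContDiff ℝ (⊤ : ℕ∞) (fun q : ℝ × E3 => φ q.1 q.2))
    (hpos : ∀ t : ℝ, ∀ x : E3, 0 < n t x ∧ 0 < p t x)
    -- the Poisson equation `Δφ = n - p` with `φ → 0` at infinity
    (hpoisson : ∀ t : ℝ, ∀ x : E3, lap (φ t) x = n t x - p t x)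
    (hφdecay : ∀ t : ℝ, Tendsto (φ t) (cocompact E3) (nhds 0))
    -- `n_t = ∇·(∇(nθ) - n∇φ)`
    (heqn : ∀ t > (0 : ℝ), ∀ x : E3,
      deriv (fun s => n s x) t =
        lap (fun y => n t y * θ t y) x - gdot (n t) (φ t) x - n t x * lap (φ t) x)
    -- `p_t = ∇·(∇(pθ) + p∇φ)`
    (heqp : ∀ t > (0 : ℝ), ∀ x : E3,
      deriv (fun s => p s x) t =
        lap (fun y => p t y * θ t y) x + gdot (p t) (φ t) x + p t x * lap (φ t) x)
    -- the temperature equation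
    (heqθ : ∀ t > (0 : ℝ), ∀ x : E3,
      c * ((n t x + p t x) * deriv (fun s => θ s x) t
          - (∑ i : Fin 3,
              (pd i (fun y => n t y * θ t y) x - n t x * pd i (φ t) x
                + pd i (fun y => p t y * θ t y) x + p t x * pd i (φ t) x)
                * pd i (θ t) x)) =
        n t x * θ t x * (∑ i : Fin 3,
            pd i (fun y => (1 / n t y)
              * (pd i (fun z => n t z * θ t z) y - n t y * pd i (φ t) y)) x)
        + p t x * θ t x * (∑ i : Fin 3,
            pd i (fun y => (1 / p t y)
              * (pd i (fun z => p t z * θ t z) y + p t y * pd i (φ t) y)) x)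
        + lap (θ t) x
        + (1 / n t x) * (∑ i : Fin 3,
            (pd i (fun y => n t y * θ t y) x - n t x * pd i (φ t) x) ^ 2)
        + (1 / p t x) * (∑ i : Fin 3,
            (pd i (fun y => p t y * θ t y) x + p t x * pd i (φ t) x) ^ 2))
    (U V Th : ℝ → E3 → ℝ)
    (hU : U = fun s y => n s y + p s y - 2)
    (hV : V = fun s y => n s y - p s y)
    (hTh : Th = fun s y => θ s y - 1) :
    -- (i)
    (∀ t > (0 : ℝ), ∀ x : E3,
      deriv (fun s => U s x) t =
        lap (U t) x + 2 * lap (Th t) x + Th t x * lap (U t) x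
          + U t x * lap (Th t) x + 2 * gdot (Th t) (U t) x
          - gdot (V t) (φ t) x - (V t x) ^ 2) ∧
    -- (ii)
    (∀ t > (0 : ℝ), ∀ x : E3,
      deriv (fun s => V s x) t =
        lap (V t) x - 2 * V t x + Th t x * lap (V t) x + V t x * lap (Th t) x
          + 2 * gdot (Th t) (V t) x - gdot (U t) (φ t) x - U t x * V t x) ∧
    -- (iii)
    (∀ t > (0 : ℝ), ∀ x : E3,
      c * deriv (fun s => Th s x) t =
        (3 / 2) * lap (Th t) x + (1 / 2) * lap (U t) x + Th t x * lap (Th t) x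
          - (U t x / (2 * (2 + U t x))) * lap (Th t) x
          + ((2 * (Th t x) ^ 2 + 4 * Th t x - U t x) / (2 * (2 + U t x)))
              * lap (U t) x
          + (c + 1) * gdot (Th t) (Th t) x
          + (c + 3) * ((1 + Th t x) / (2 + U t x)) * gdot (U t) (Th t) x
          - 2 * ((1 + Th t x) / (2 + U t x)) * gdot (V t) (φ t) x
          - (c + 2) * (V t x / (2 + U t x)) * gdot (Th t) (φ t) x
          - ((1 + Th t x) / (2 + U t x)) * (V t x) ^ 2
          + gdot (φ t) (φ t) x) := by
  subst hU hV hTh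
  have slice : ∀ {f : ℝ → E3 → ℝ}, ContDiff ℝ (⊤ : ℕ∞) (fun q : ℝ × E3 => f q.1 q.2) →
      ∀ t, ContDiff ℝ (⊤ : ℕ∞) (f t) := fun hf t =>
    hf.comp (contDiff_const.prodMk contDiff_id)
  have time : ∀ {f : ℝ → E3 → ℝ}, ContDiff ℝ (⊤ : ℕ∞) (fun q : ℝ × E3 => f q.1 q.2) →
      ∀ t x, DifferentiableAt ℝ (fun s => f s x) t := fun {f} hf t x =>
    (hf.comp (contDiff_id.prodMk contDiff_const) :
      ContDiff ℝ (⊤ : ℕ∞) (fun s => f s x)).differentiable (by simp) t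
  refine ⟨fun t ht x => ?_, fun t ht x => ?_, fun t ht x => ?_⟩
  all_goals
    have hnt := slice hn t
    have hpt := slice hp t
    have hθt := slice hθ t
    have hφt := slice hφ t
    have n0 := hnt.differentiableAt_of_smooth x
    have p0 := hpt.differentiableAt_of_smooth x
    have hl := hpoisson t x
    simp only [gdot_sub_const_right, gdot_sub_const_left, lap_sub_const,
      lap_add hnt hpt, lap_sub hnt hpt, gdot_comm (θ t) (fun y => n t y + p t y),
      gdot_comm (θ t) (fun y => n t y - p t y), gdot_add_left _ n0 p0, gdot_sub_left _ n0 p0]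
  · rw [deriv_sub_const, deriv_fun_add (time hn t x) (time hp t x), heqn t ht, heqp t ht,
      lap_mul hnt hθt, lap_mul hpt hθt, hl]
    ring
  · rw [deriv_fun_sub (time hn t x) (time hp t x), heqn t ht, heqp t ht,
      lap_mul hnt hθt, lap_mul hpt hθt, hl]
    ring
  · have en := species_heating (-1) (by norm_num) hnt hθt hφt (fun y => (hpos t y).1.ne') x
    have ep := species_heating 1 (by norm_num) hpt hθt hφt (fun y => (hpos t y).2.ne') x
    simp only [neg_one_mul, ← sub_eq_add_neg, one_mul] at en ep
    have drift : (∑ i : Fin 3,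
        (pd i (fun y => n t y * θ t y) x - n t x * pd i (φ t) x
          + pd i (fun y => p t y * θ t y) x + p t x * pd i (φ t) x) * pd i (θ t) x) =
        θ t x * (gdot (n t) (θ t) x + gdot (p t) (θ t) x)
          + (n t x + p t x) * gdot (θ t) (θ t) x
          - (n t x - p t x) * gdot (θ t) (φ t) x := by
      simp only [gdot, Finset.mul_sum, ← Finset.sum_add_distrib, ← Finset.sum_sub_distrib]
      refine Finset.sum_congr rfl fun i _ => ?_
      rw [pd_mul i n0 (hθt.differentiableAt_of_smooth x),
        pd_mul i p0 (hθt.differentiableAt_of_smooth x)]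
      ring
    have heat := heqθ t ht x
    rw [drift] at heat
    rw [hl] at en ep
    have hS : n t x + p t x ≠ 0 := (add_pos (hpos t x).1 (hpos t x).2).ne'
    rw [deriv_sub_const, show 2 + (n t x + p t x - 2) = n t x + p t x by ring]
    field_simp
    linear_combination 2 * heat + 2 * en + 2 * ep
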